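/- Let f : ℝ^d → ℝ satisfy the standing assumptions, and let x lie in the basin of attraction of a mode x_* of f (with x_* non-degenerate, as guaranteed by the Morse assumption). For η > 0 let Q_η denote the polygonal line connecting consecutive points of the sequence produced by Algorithm 1 started at x with level step η, and let Z denote the gradient ascent line {γ_x(t) : t ≥ 0} ∪ {x_*}. Then there exist a constant C > 0 and η₀ > 0, depending on f and x, such that for all 0 < η ≤ η₀ the Hausdorff distance satisfies d_H(Q_η, Z) ≤ C√η. -/

import Mathlib

open Metric Set Filter Topology MeasureTheory

noncomputable section

variable {d : ℕ}

/-- Standing assumptions on the density `f`: twice continuously differentiable with bounded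
values, gradient and Hessian; vanishing at infinity; Morse (non-degenerate critical points). -/
def StandingAssumptions (f : EuclideanSpace ℝ (Fin d) → ℝ) : Prop :=
  ContDiff ℝ 2 f ∧
  (∃ M, ∀ x, |f x| ≤ M) ∧
  (∃ M, ∀ x, ‖gradient f x‖ ≤ M) ∧
  (∃ M, ∀ x, ‖fderiv ℝ (gradient f) x‖ ≤ M) ∧
  Tendsto f (cocompact (EuclideanSpace ℝ (Fin d))) (nhds 0) ∧
  (∀ x, gradient f x = 0 → Function.Bijective (fderiv ℝ (gradient f) x))

/-- `γ` is the gradient flow line of `f` starting at `x`. -/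
def IsGradientFlow (f : EuclideanSpace ℝ (Fin d) → ℝ) (x : EuclideanSpace ℝ (Fin d))
    (γ : ℝ → EuclideanSpace ℝ (Fin d)) : Prop :=
  γ 0 = x ∧ ∀ t : ℝ, 0 ≤ t → HasDerivAt γ (gradient f (γ t)) t

/-- `x` lies in the basin of attraction of `x₀` for the gradient flow of `f`. -/
def InBasin (f : EuclideanSpace ℝ (Fin d) → ℝ) (x₀ x : EuclideanSpace ℝ (Fin d)) : Prop :=
  ∃ γ : ℝ → EuclideanSpace ℝ (Fin d), IsGradientFlow f x γ ∧ Tendsto γ atTop (nhds x₀)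

/-- `p` is a metric projection of `y` onto the set `A`. -/
def IsProjOn (A : Set (EuclideanSpace ℝ (Fin d))) (y p : EuclideanSpace ℝ (Fin d)) : Prop :=
  p ∈ A ∧ dist y p = infDist y A

/-- A complete run of Algorithm 1 with level step `η`, starting point `x`:
`q 0 = x`; for each step `k < K` the point `q (k+1)` is a metric projection of `q k` onto the
level set at level `f x + (k+1)·η` and it stays in the connected component of the upper level
set at level `f x + k·η` containing `q k`; at step `K` the stopping rule triggers (the next
level set is empty, or a projection leaves the current connected component); and `r` is a
maximizer of `f` over the current connected component (the returned point). -/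
def Alg1Run (f : EuclideanSpace ℝ (Fin d) → ℝ) (x : EuclideanSpace ℝ (Fin d)) (η : ℝ)
    (q : ℕ → EuclideanSpace ℝ (Fin d)) (K : ℕ) (r : EuclideanSpace ℝ (Fin d)) : Prop :=
  q 0 = x ∧
  (∀ k < K,
    IsProjOn {y | f y = f x + ((k : ℝ) + 1) * η} (q k) (q (k + 1)) ∧
    q (k + 1) ∈ connectedComponentIn {y | f x + (k : ℝ) * η ≤ f y} (q k)) ∧
  ({y | f y = f x + ((K : ℝ) + 1) * η} = ∅ ∨
    ∃ p, IsProjOn {y | f y = f x + ((K : ℝ) + 1) * η} (q K) p ∧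
      p ∉ connectedComponentIn {y | f x + (K : ℝ) * η ≤ f y} (q K)) ∧
  r ∈ connectedComponentIn {y | f x + (K : ℝ) * η ≤ f y} (q K) ∧
  ∀ y ∈ connectedComponentIn {y | f x + (K : ℝ) * η ≤ f y} (q K), f y ≤ f r

/-- The polygonal line connecting the consecutive points `q 0, q 1, …, q K`. -/
def Polyline (q : ℕ → EuclideanSpace ℝ (Fin d)) (K : ℕ) : Set (EuclideanSpace ℝ (Fin d)) :=
  {q 0} ∪ ⋃ k ∈ Finset.range K, segment ℝ (q k) (q (k + 1))

section Gradient

variable {E : Type*} [NormedAddCommGroup E] [InnerProductSpace ℝ E] [CompleteSpace E]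
  {f : E → ℝ} {M : ℝ}

theorem hasDerivAt_comp_line (hf : Differentiable ℝ f) (a v : E) (s : ℝ) :
    HasDerivAt (fun s : ℝ => f (a + s • v)) (inner ℝ (gradient f (a + s • v)) v) s := by
  have h1 : HasDerivAt (fun s : ℝ => a + s • v) v s := by
    simpa using ((hasDerivAt_id s).smul_const v).const_add a
  have h2 := (hf (a + s • v)).hasFDerivAt.comp_hasDerivAt s h1
  rwa [← inner_gradient_left] at h2

/-- First order Taylor estimate for a function with Lipschitz gradient. -/
theorem abs_sub_sub_inner_gradient_le (hf : Differentiable ℝ f) (hM : 0 ≤ M)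
    (hL : ∀ x y, ‖gradient f x - gradient f y‖ ≤ M * ‖x - y‖) (x y : E) :
    |f y - f x - inner ℝ (gradient f x) (y - x)| ≤ M * ‖y - x‖ ^ 2 := by
  have key := (convex_closedBall x ‖y - x‖).norm_image_sub_le_of_norm_fderiv_le'
    (f := f) (φ := fderiv ℝ f x) (C := M * ‖y - x‖) (𝕜 := ℝ) (fun z _ => hf z)
    (fun z hz => by
      have h1 : fderiv ℝ f z - fderiv ℝ f x
          = InnerProductSpace.toDual ℝ E (gradient f z - gradient f x) := by
        simp [gradient]
      rw [h1, LinearIsometryEquiv.norm_map]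
      refine (hL z x).trans ?_
      rw [mem_closedBall, dist_eq_norm] at hz
      gcongr)
    (x := x) (y := y) (by simp) (by simp [dist_eq_norm])
  rw [← inner_gradient_left, Real.norm_eq_abs] at key
  nlinarith

/-- Moving along the gradient reaches the level `f q + η` within distance `2 η / ‖∇ f q‖`. -/
theorem exists_level_eq_dist_le (hf : Differentiable ℝ f) (hM : 0 ≤ M)
    (hL : ∀ x y, ‖gradient f x - gradient f y‖ ≤ M * ‖x - y‖) {q : E} {η : ℝ} (hη : 0 < η)
    (hg : 0 < ‖gradient f q‖) (hs : 16 * M * η ≤ ‖gradient f q‖ ^ 2) :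
    ∃ y, f y = f q + η ∧ dist q y ≤ 2 * η / ‖gradient f q‖ := by
  set g := ‖gradient f q‖ with hgdef
  set s₁ := 2 * η / g ^ 2 with hs₁
  have hs₁0 : 0 ≤ s₁ := by positivity
  have hg2 : s₁ * g ^ 2 = 2 * η := by rw [hs₁]; field_simp
  have hcont : ContinuousOn (fun s : ℝ => f (q + s • gradient f q)) (Icc 0 s₁) :=
    fun s _ => (hasDerivAt_comp_line hf q _ s).continuousAt.continuousWithinAt
  have hend : f q + η ≤ f (q + s₁ • gradient f q) := by
    have h := (abs_le.1 (abs_sub_sub_inner_gradient_le hf hM hL q (q + s₁ • gradient f q))).1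
    simp only [add_sub_cancel_left, inner_smul_right, real_inner_self_eq_norm_sq, norm_smul,
      Real.norm_eq_abs, mul_pow, sq_abs, ← hgdef] at h
    have h3 : M * (s₁ ^ 2 * g ^ 2) = s₁ * (2 * M * η) := by
      rw [pow_two s₁, mul_assoc, hg2]; ring
    have h4 : s₁ * (16 * M * η) ≤ s₁ * g ^ 2 := by gcongr
    nlinarith
  obtain ⟨s, ⟨hs0, hs1⟩, hfs⟩ := intermediate_value_Icc hs₁0 hcont
    (show f q + η ∈ Icc _ _ from ⟨by simp [hη.le], hend⟩)
  refine ⟨_, hfs, ?_⟩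
  rw [dist_self_add_right, norm_smul, Real.norm_of_nonneg hs0, ← hgdef]
  calc s * g ≤ s₁ * g := by gcongr
    _ = 2 * η / g := by rw [hs₁]; field_simp

/-- The displacement to the metric projection on a level set is parallel to the gradient at
the projected point. -/
theorem exists_sub_eq_smul_gradient_of_dist_eq_infDist (hf : ContDiff ℝ 1 f) {q p : E} {c : ℝ}
    (hp : f p = c) (hd : dist q p = infDist q {y | f y = c}) (hg : gradient f p ≠ 0) :
    ∃ h : ℝ, p - q = h • gradient f p := by
  have hext : IsLocalExtrOn (fun y => ‖y - q‖ ^ 2) {y | f y = f p} p := by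
    left
    refine Filter.eventually_inf_principal.2 (Eventually.of_forall fun y hy => ?_)
    have : dist q p ≤ dist q y := by
      rw [hd]; exact infDist_le_dist_of_mem (by rw [← hp]; exact hy)
    rw [dist_comm, dist_comm q y, dist_eq_norm, dist_eq_norm] at this
    show ‖p - q‖ ^ 2 ≤ ‖y - q‖ ^ 2
    gcongr
  have h1 := hf.contDiffAt.hasStrictFDerivAt (x := p) one_ne_zero
  have h2 : HasStrictFDerivAt (fun y => ‖y - q‖ ^ 2) (2 • (innerSL ℝ (p - q))) p := by
    simpa using (hasStrictFDerivAt_norm_sq (p - q)).comp p ((hasStrictFDerivAt_id p).sub_const q)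
  obtain ⟨a, b, hab, hsum⟩ := hext.exists_multipliers_of_hasStrictFDerivAt_1d h1 h2
  have h3 : a • gradient f p + (2 * b) • (p - q) = 0 := by
    refine ext_inner_right ℝ fun v => ?_
    have := congrArg (fun φ => φ v) hsum
    simp at this
    simp only [inner_add_left, real_inner_smul_left, inner_sub_left, inner_gradient_left,
      inner_zero_left]
    linarith
  have hb : b ≠ 0 := by
    rintro rfl
    have ha : a ≠ 0 := by rintro rfl; simp at hab
    simp [ha, hg] at h3
  refine ⟨-a / (2 * b), ?_⟩
  have h4 : (2 * b) • (p - q) = (-a) • gradient f p := by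
    rw [neg_smul]; exact eq_neg_of_add_eq_zero_right h3
  rw [div_eq_inv_mul, mul_smul, ← h4, smul_smul, inv_mul_cancel₀ (by simpa using hb), one_smul]

/-- A small projection step from `q` to the level `f q + η` is an implicit Euler step for the
gradient flow, and it does not leave the connected component of the upper level set. -/
theorem level_projection_step (hf : ContDiff ℝ 1 f) (hM : 0 ≤ M)
    (hL : ∀ x y, ‖gradient f x - gradient f y‖ ≤ M * ‖x - y‖) {q p : E} {η : ℝ} (hη : 0 < η)
    (hg : 0 < ‖gradient f q‖) (hs : 16 * M * η ≤ ‖gradient f q‖ ^ 2)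
    (hp : f p = f q + η) (hd : dist q p = infDist q {y | f y = f q + η}) :
    dist q p ≤ 2 * η / ‖gradient f q‖ ∧
    (∃ h : ℝ, 0 ≤ h ∧ h ≤ 4 * η / ‖gradient f q‖ ^ 2 ∧ p - q = h • gradient f p) ∧
    p ∈ connectedComponentIn {y | f q ≤ f y} q := by
  have hdiff : Differentiable ℝ f := hf.differentiable one_ne_zero
  obtain ⟨y, hy, hqy⟩ := exists_level_eq_dist_le hdiff hM hL hη hg hs
  have hδ : dist q p ≤ 2 * η / ‖gradient f q‖ := by
    rw [hd]; exact (infDist_le_dist_of_mem (by exact hy)).trans hqy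
  set g := ‖gradient f q‖ with hgdef
  have hMδ : M * ‖p - q‖ ≤ g / 8 := by
    rw [← dist_eq_norm, dist_comm]
    calc M * dist q p ≤ M * (2 * η / g) := by gcongr
      _ = (16 * M * η) / (8 * g) := by field_simp; ring
      _ ≤ g ^ 2 / (8 * g) := by gcongr
      _ = g / 8 := by field_simp
  have hG : g / 2 ≤ ‖gradient f p‖ := by
    have h1 := hL q p
    have h2 := norm_sub_norm_le (gradient f q) (gradient f p)
    rw [norm_sub_rev q p] at h1
    linarith
  have hG0 : gradient f p ≠ 0 := by rw [← norm_pos_iff]; linarith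
  obtain ⟨h, hh⟩ := exists_sub_eq_smul_gradient_of_dist_eq_infDist hf hp hd hG0
  set G := ‖gradient f p‖ with hGdef
  have hGpos : 0 < G := by linarith
  have hnorm : ‖p - q‖ = |h| * G := by rw [hh, norm_smul, Real.norm_eq_abs]
  have hpos : 0 ≤ h := by
    by_contra! hneg
    have h1 := (abs_le.1 (abs_sub_sub_inner_gradient_le hdiff hM hL p q)).1
    have h2 : inner ℝ (gradient f p) (q - p) = |h| * G ^ 2 := by
      rw [← neg_sub, hh, inner_neg_right, inner_smul_right, real_inner_self_eq_norm_sq,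
        abs_of_neg hneg]; ring
    rw [h2, norm_sub_rev, hp, pow_two, ← mul_assoc] at h1
    have h3 : M * ‖p - q‖ * ‖p - q‖ ≤ G * ‖p - q‖ := by gcongr; linarith
    rw [hnorm] at h3 h1
    nlinarith
  refine ⟨hδ, ⟨h, hpos, ?_, hh⟩, ?_⟩
  · have h1 : h * (g / 2) ≤ 2 * η / g := by
      calc h * (g / 2) ≤ h * G := by gcongr
        _ = dist q p := by rw [dist_comm, dist_eq_norm, hnorm, abs_of_nonneg hpos]
        _ ≤ _ := hδ
    rw [le_div_iff₀ (by positivity)] at h1 ⊢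
    nlinarith
  · have hmono : MonotoneOn (fun s : ℝ => f (q + s • (p - q))) (Icc 0 1) := by
      refine monotoneOn_of_deriv_nonneg (convex_Icc 0 1)
        (fun s _ => (hasDerivAt_comp_line hdiff q _ s).continuousAt.continuousWithinAt)
        (fun s _ => (hasDerivAt_comp_line hdiff q _ s).differentiableAt.differentiableWithinAt) ?_
      intro s hs'
      rw [interior_Icc] at hs'
      rw [(hasDerivAt_comp_line hdiff q _ s).deriv]
      set z := q + s • (p - q) with hz
      have h1 : ‖z - p‖ ≤ ‖p - q‖ := by
        have : z - p = (s - 1) • (p - q) := by rw [hz]; module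
        rw [this, norm_smul, Real.norm_eq_abs]
        have : |s - 1| ≤ 1 := abs_le.2 ⟨by linarith [hs'.1], by linarith [hs'.2]⟩
        nlinarith [norm_nonneg (p - q)]
      have h2 : ‖gradient f z - gradient f p‖ ≤ G := by
        refine (hL z p).trans ?_
        have : M * ‖z - p‖ ≤ M * ‖p - q‖ := by gcongr
        linarith
      rw [hh, inner_smul_right]
      refine mul_nonneg hpos ?_
      have h3 : inner ℝ (gradient f z) (gradient f p)
          = inner ℝ (gradient f z - gradient f p) (gradient f p) + G ^ 2 := by
        rw [inner_sub_left, real_inner_self_eq_norm_sq]; ring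
      have h4 := (abs_le.1 (abs_real_inner_le_norm (gradient f z - gradient f p)
        (gradient f p))).1
      rw [h3]
      nlinarith
    have hseg : segment ℝ q p ⊆ {y | f q ≤ f y} := by
      rw [segment_eq_image']
      rintro _ ⟨s, hs', rfl⟩
      have := hmono (left_mem_Icc.2 zero_le_one) hs' hs'.1
      simpa using this
    exact (convex_segment q p).isPreconnected.subset_connectedComponentIn
      (left_mem_segment ℝ q p) hseg (right_mem_segment ℝ q p)

/-- Error propagation for one implicit Euler step of the gradient flow. -/
theorem implicit_euler_error (hM : 0 ≤ M)
    (hL : ∀ x y, ‖gradient f x - gradient f y‖ ≤ M * ‖x - y‖) {γ : ℝ → E} {q p : E}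
    {τ h κ N : ℝ} (hh : 0 ≤ h) (hγ : ∀ t ∈ Icc τ (τ + h), HasDerivAt γ (gradient f (γ t)) t)
    (hN : ∀ t ∈ Icc τ (τ + h), ‖gradient f (γ t)‖ ≤ N) (hp : p - q = h • gradient f p)
    (hκ : inner ℝ (gradient f p - gradient f (γ (τ + h))) (p - γ (τ + h)) ≤
      -κ * ‖p - γ (τ + h)‖ ^ 2) :
    (∀ t ∈ Icc τ (τ + h), ‖γ t - γ (τ + h)‖ ≤ N * h) ∧
    (1 + κ * h) * ‖p - γ (τ + h)‖ ≤ ‖q - γ τ‖ + h * (M * (N * h)) := by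
  have hl : τ ∈ Icc τ (τ + h) := left_mem_Icc.2 (by linarith)
  have hr : τ + h ∈ Icc τ (τ + h) := right_mem_Icc.2 (by linarith)
  have hN0 : 0 ≤ N := (norm_nonneg _).trans (hN τ hl)
  have hdisp : ∀ t ∈ Icc τ (τ + h), ‖γ t - γ (τ + h)‖ ≤ N * h := by
    intro t ht
    have := (convex_Icc τ (τ + h)).norm_image_sub_le_of_norm_hasDerivWithin_le
      (fun t ht => (hγ t ht).hasDerivWithinAt) hN hr ht
    refine this.trans ?_
    rw [Real.norm_eq_abs, abs_of_nonpos (by linarith [ht.2])]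
    gcongr
    linarith [ht.1]
  refine ⟨hdisp, ?_⟩
  set z := γ (τ + h) with hz
  set w := gradient f z with hw
  have hloc : ‖h • w - (z - γ τ)‖ ≤ h * (M * (N * h)) := by
    have := (convex_Icc τ (τ + h)).norm_image_sub_le_of_norm_hasDerivWithin_le
      (f := fun t => γ t - t • w) (f' := fun t => gradient f (γ t) - w) (C := M * (N * h))
      (fun t ht => ((hγ t ht).sub (by simpa using (hasDerivAt_id t).smul_const w)).hasDerivWithinAt)
      (fun t ht => (hL _ _).trans (by gcongr; exact hdisp t ht)) hl hr
    rw [norm_sub_rev]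
    calc ‖z - γ τ - h • w‖ = ‖(γ (τ + h) - (τ + h) • w) - (γ τ - τ • w)‖ := by
          congr 1; rw [hz]; module
      _ ≤ _ := this
      _ = _ := by rw [add_sub_cancel_left, Real.norm_of_nonneg hh]; ring
  have heq : p - z = (q - γ τ) + (h • w - (z - γ τ)) + h • (gradient f p - w) := by
    rw [smul_sub, ← hp]; module
  have hsq : ‖p - z‖ ^ 2 ≤ (‖q - γ τ‖ + h * (M * (N * h))) * ‖p - z‖
      + h * (-κ * ‖p - z‖ ^ 2) := by
    calc ‖p - z‖ ^ 2 = inner ℝ (p - z) (p - z) := (real_inner_self_eq_norm_sq _).symm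
      _ = inner ℝ ((q - γ τ) + (h • w - (z - γ τ))) (p - z)
          + h * inner ℝ (gradient f p - w) (p - z) := by
        nth_rewrite 1 [heq]
        rw [inner_add_left, inner_smul_left]; rfl
      _ ≤ _ := by
        gcongr
        refine (real_inner_le_norm _ _).trans ?_
        gcongr
        exact (norm_add_le _ _).trans (by gcongr)
  rcases (norm_nonneg (p - z)).eq_or_lt with h0 | h0
  · rw [← h0, mul_zero]; positivity
  · refine le_of_mul_le_mul_right ?_ h0
    nlinarith

end Gradient

section LocalMax

variable {E : Type*} [NormedAddCommGroup E] [InnerProductSpace ℝ E] [CompleteSpace E]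
  {f : E → ℝ} {a : E}

theorem contDiff_gradient (hf : ContDiff ℝ 2 f) : ContDiff ℝ 1 (gradient f) := by
  have h1 : ContDiff ℝ 1 (fderiv ℝ f) := hf.fderiv_right (by norm_num)
  exact (InnerProductSpace.toDual ℝ E).symm.contDiff.comp h1

theorem inner_fderiv_gradient (hf : ContDiff ℝ 2 f) (v w : E) :
    inner ℝ (fderiv ℝ (gradient f) a v) w = fderiv ℝ (fderiv ℝ f) a v w := by
  have h1 : ContDiff ℝ 1 (fderiv ℝ f) := hf.fderiv_right (by norm_num)
  have h2 : HasFDerivAt (gradient f)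
      ((InnerProductSpace.toDual ℝ E).symm.toContinuousLinearEquiv.toContinuousLinearMap.comp
        (fderiv ℝ (fderiv ℝ f) a)) a :=
    (InnerProductSpace.toDual ℝ E).symm.toContinuousLinearEquiv.hasFDerivAt.comp a
      (h1.differentiable one_ne_zero a).hasFDerivAt
  rw [h2.fderiv]
  simp [InnerProductSpace.toDual_symm_apply]

theorem inner_fderiv_gradient_comm (hf : ContDiff ℝ 2 f) (v w : E) :
    inner ℝ (fderiv ℝ (gradient f) a v) w = inner ℝ (fderiv ℝ (gradient f) a w) v := by
  rw [inner_fderiv_gradient hf, inner_fderiv_gradient hf]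
  exact (hf.contDiffAt.isSymmSndFDerivAt (by simp)) v w

theorem gradient_eq_zero_of_isLocalMax (h : IsLocalMax f a) : gradient f a = 0 := by
  simp [gradient, h.fderiv_eq_zero]

/-- Second order necessary condition at a local maximum. -/
theorem inner_fderiv_gradient_nonpos (hf : ContDiff ℝ 2 f) (hmax : IsLocalMax f a) (v : E) :
    inner ℝ (fderiv ℝ (gradient f) a v) v ≤ 0 := by
  by_contra! hpos
  have hdiff : Differentiable ℝ f := hf.differentiable two_ne_zero
  have hline : HasDerivAt (fun s : ℝ => a + s • v) v 0 := by
    simpa using ((hasDerivAt_id (0 : ℝ)).smul_const v).const_add a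
  have hder : HasDerivAt (fun s : ℝ => inner ℝ (gradient f (a + s • v)) v)
      (inner ℝ (fderiv ℝ (gradient f) a v) v) 0 := by
    have h1 : HasFDerivAt (gradient f) (fderiv ℝ (gradient f) a) (a + (0 : ℝ) • v) := by
      simpa using ((contDiff_gradient hf).differentiable one_ne_zero a).hasFDerivAt
    simpa using (h1.comp_hasDerivAt (0 : ℝ) hline).inner ℝ (hasDerivAt_const (0 : ℝ) v)
  have h0 : inner ℝ (gradient f (a + (0 : ℝ) • v)) v = 0 := by
    simp [gradient_eq_zero_of_isLocalMax hmax]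
  have hslope := hder.tendsto_slope_zero_right
  simp only [zero_add, h0, sub_zero] at hslope
  have hev : ∀ᶠ s : ℝ in 𝓝[>] 0, 0 < inner ℝ (gradient f (a + s • v)) v := by
    filter_upwards [hslope.eventually_const_lt hpos, self_mem_nhdsWithin] with s hs hs0
    rw [smul_eq_mul] at hs
    exact (pos_iff_pos_of_mul_pos hs).1 (inv_pos.2 hs0)
  have hmax' : ∀ᶠ s : ℝ in 𝓝[>] 0, f (a + s • v) ≤ f a := by
    have : Tendsto (fun s : ℝ => a + s • v) (𝓝 0) (𝓝 a) := by
      simpa using hline.continuousAt.tendsto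
    exact (this.eventually hmax).filter_mono nhdsWithin_le_nhds
  obtain ⟨s₀, hs₀, hIoo⟩ := (mem_nhdsGT_iff_exists_Ioo_subset).1 (hev.and hmax')
  have hmono : StrictMonoOn (fun s : ℝ => f (a + s • v)) (Icc 0 (s₀ / 2)) := by
    refine strictMonoOn_of_deriv_pos (convex_Icc _ _)
      (fun s _ => (hasDerivAt_comp_line hdiff a v s).continuousAt.continuousWithinAt) ?_
    intro s hs
    rw [interior_Icc] at hs
    rw [(hasDerivAt_comp_line hdiff a v s).deriv]
    exact (hIoo ⟨hs.1, by linarith [hs.1, hs.2]⟩).1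
  have hs₀' : (0 : ℝ) < s₀ := hs₀
  have h1 := hmono (left_mem_Icc.2 (by linarith)) (right_mem_Icc.2 (by linarith))
    (show (0 : ℝ) < s₀ / 2 by linarith)
  have h2 := (hIoo ⟨(by linarith : (0 : ℝ) < s₀ / 2), by linarith⟩).2
  simp only [zero_smul, add_zero] at h1
  linarith

/-- At a non-degenerate local maximum the Hessian is negative definite. -/
theorem inner_fderiv_gradient_neg (hf : ContDiff ℝ 2 f) (hmax : IsLocalMax f a)
    (hinj : Function.Injective (fderiv ℝ (gradient f) a)) {v : E} (hv : v ≠ 0) :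
    inner ℝ (fderiv ℝ (gradient f) a v) v < 0 := by
  refine lt_of_le_of_ne (inner_fderiv_gradient_nonpos hf hmax v) fun h0 => hv ?_
  set H := fderiv ℝ (gradient f) a with hH
  have hw : ∀ w, inner ℝ (H v) w = 0 := by
    intro w
    have hd : discrim (-inner ℝ (H w) w) (-(2 * inner ℝ (H v) w)) 0 ≤ 0 := by
      refine discrim_le_zero fun s => ?_
      have h1 := inner_fderiv_gradient_nonpos hf hmax (v + s • w)
      have h2 := inner_fderiv_gradient_comm (a := a) hf v w
      rw [← hH] at h1 h2
      simp only [map_add, map_smul, inner_add_left, inner_add_right, real_inner_smul_left,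
        inner_smul_right] at h1
      rw [h0, ← h2] at h1
      nlinarith
    rw [discrim] at hd
    nlinarith [sq_nonneg (inner ℝ (H v) w)]
  have hHv : H v = 0 := by
    simpa using hw (H v)
  exact hinj (by rw [hHv, map_zero])

/-- Near a non-degenerate local maximum the gradient is strongly monotone. -/
theorem exists_strong_monotone_gradient [FiniteDimensional ℝ E] (hf : ContDiff ℝ 2 f)
    (hmax : IsLocalMax f a) (hinj : Function.Injective (fderiv ℝ (gradient f) a)) :
    ∃ m > 0, ∃ r > 0, ∀ x ∈ closedBall a r, ∀ y ∈ closedBall a r,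
      inner ℝ (gradient f x - gradient f y) (x - y) ≤ -m * ‖x - y‖ ^ 2 := by
  set H := fderiv ℝ (gradient f) a with hH
  obtain ⟨c, hc, hcH⟩ : ∃ c > 0, ∀ v, inner ℝ (H v) v ≤ -c * ‖v‖ ^ 2 := by
    have hcont : Continuous fun v => -inner ℝ (H v) v := by fun_prop
    rcases (sphere (0 : E) 1).eq_empty_or_nonempty with hemp | hne
    · have hsub : ∀ v : E, v = 0 := by
        intro v
        by_contra hv
        have : (‖v‖⁻¹ • v) ∈ sphere (0 : E) 1 := by
          simp [norm_smul, inv_mul_cancel₀ (norm_ne_zero_iff.2 hv)]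
        simp [hemp] at this
      exact ⟨1, one_pos, fun v => by simp [hsub v]⟩
    · obtain ⟨u, hu, hmin⟩ := (isCompact_sphere (0 : E) 1).exists_isMinOn hne hcont.continuousOn
      have hu0 : u ≠ 0 := by rintro rfl; simp at hu
      refine ⟨_, neg_pos.2 (inner_fderiv_gradient_neg hf hmax hinj hu0), fun v => ?_⟩
      rcases eq_or_ne v 0 with rfl | hv
      · simp
      · have hn : 0 < ‖v‖ := norm_pos_iff.2 hv
        have hmem : (‖v‖⁻¹ • v) ∈ sphere (0 : E) 1 := by
          simp [norm_smul, inv_mul_cancel₀ hn.ne']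
        have h1 := hmin hmem
        simp only [mem_ofPred_eq, map_smul, real_inner_smul_left, inner_smul_right] at h1
        have h2 : ‖v‖⁻¹ * (‖v‖⁻¹ * inner ℝ (H v) v) * ‖v‖ ^ 2 = inner ℝ (H v) v := by
          field_simp
        nlinarith [sq_nonneg ‖v‖]
  have hstrict : HasStrictFDerivAt (gradient f) H a :=
    (contDiff_gradient hf).contDiffAt.hasStrictFDerivAt one_ne_zero
  have hev := (hasStrictFDerivAt_iff_isLittleO.1 hstrict).def (half_pos hc)
  obtain ⟨r, hr, hball⟩ := (nhds_basis_closedBall.prod_nhds nhds_basis_closedBall).mem_iff.1 hev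
  refine ⟨c / 2, half_pos hc, min r.1 r.2, lt_min hr.1 hr.2, fun x hx y hy => ?_⟩
  have h1 : ‖gradient f x - gradient f y - H (x - y)‖ ≤ c / 2 * ‖x - y‖ :=
    hball (show (x, y) ∈ closedBall a r.1 ×ˢ closedBall a r.2 from
      ⟨closedBall_subset_closedBall (min_le_left _ _) hx,
        closedBall_subset_closedBall (min_le_right _ _) hy⟩)
  have h2 := real_inner_le_norm (gradient f x - gradient f y - H (x - y)) (x - y)
  have h3 : inner ℝ (gradient f x - gradient f y) (x - y)
      = inner ℝ (gradient f x - gradient f y - H (x - y)) (x - y)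
        + inner ℝ (H (x - y)) (x - y) := by
    rw [← inner_add_left, sub_add_cancel]
  have h4 := hcH (x - y)
  rw [h3]
  nlinarith [norm_nonneg (x - y)]

end LocalMax

section StronglyConcave

variable {E : Type*} [NormedAddCommGroup E] [InnerProductSpace ℝ E] [CompleteSpace E]
  {f : E → ℝ} {a : E} {m r : ℝ}

theorem mul_norm_sub_le_norm_gradient (ha : gradient f a = 0) (hr : 0 ≤ r)
    (hmono : ∀ x ∈ closedBall a r, ∀ y ∈ closedBall a r,
      inner ℝ (gradient f x - gradient f y) (x - y) ≤ -m * ‖x - y‖ ^ 2)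
    {x : E} (hx : x ∈ closedBall a r) : m * ‖x - a‖ ≤ ‖gradient f x‖ := by
  have h1 := hmono x hx a (mem_closedBall_self hr)
  rw [ha, sub_zero] at h1
  have h2 := (abs_le.1 (abs_real_inner_le_norm (gradient f x) (x - a))).1
  rcases (norm_nonneg (x - a)).eq_or_lt with h0 | h0
  · rw [← h0]; simp
  · refine le_of_mul_le_mul_right ?_ h0
    nlinarith

/-- Quadratic growth below a maximum of a strongly concave function. -/
theorem le_sub_sq_of_strong_monotone_gradient (hf : Differentiable ℝ f) (ha : gradient f a = 0)
    (hmono : ∀ x ∈ closedBall a r, ∀ y ∈ closedBall a r,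
      inner ℝ (gradient f x - gradient f y) (x - y) ≤ -m * ‖x - y‖ ^ 2)
    {x : E} (hx : x ∈ closedBall a r) : f x ≤ f a - m / 2 * ‖x - a‖ ^ 2 := by
  have hr : 0 ≤ r := dist_nonneg.trans hx
  set v := x - a with hv
  have hder : ∀ s : ℝ, HasDerivAt (fun s : ℝ => f (a + s • v) + m / 2 * ‖v‖ ^ 2 * s ^ 2)
      (inner ℝ (gradient f (a + s • v)) v + m * ‖v‖ ^ 2 * s) s := by
    intro s
    have := (hasDerivAt_comp_line hf a v s).add ((hasDerivAt_pow 2 s).const_mul (m / 2 * ‖v‖ ^ 2))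
    convert! this using 1
    simp; ring
  have hanti : AntitoneOn (fun s : ℝ => f (a + s • v) + m / 2 * ‖v‖ ^ 2 * s ^ 2) (Icc 0 1) := by
    refine antitoneOn_of_deriv_nonpos (convex_Icc 0 1)
      (fun s _ => (hder s).continuousAt.continuousWithinAt)
      (fun s _ => (hder s).differentiableAt.differentiableWithinAt) fun s hs => ?_
    rw [interior_Icc] at hs
    rw [(hder s).deriv]
    have hmem : a + s • v ∈ closedBall a r := by
      rw [mem_closedBall, dist_eq_norm] at hx ⊢
      rw [add_sub_cancel_left, norm_smul, Real.norm_of_nonneg hs.1.le]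
      nlinarith [norm_nonneg v, hs.2]
    have h1 := hmono _ hmem a (mem_closedBall_self hr)
    rw [ha, sub_zero, add_sub_cancel_left, inner_smul_right, norm_smul, mul_pow,
      Real.norm_eq_abs, sq_abs] at h1
    refine le_of_mul_le_mul_left ?_ hs.1
    nlinarith
  have := hanti (left_mem_Icc.2 zero_le_one) (right_mem_Icc.2 zero_le_one) zero_le_one
  simp [hv] at this
  linarith

/-- The distance to the maximum is nonincreasing along the gradient flow. -/
theorem norm_gradientFlow_sub_antitone (ha : gradient f a = 0) (hm : 0 ≤ m)
    (hmono : ∀ x ∈ closedBall a r, ∀ y ∈ closedBall a r,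
      inner ℝ (gradient f x - gradient f y) (x - y) ≤ -m * ‖x - y‖ ^ 2) {γ : ℝ → E} {T : ℝ}
    (hγ : ∀ t, T ≤ t → HasDerivAt γ (gradient f (γ t)) t)
    (hT : ∀ t, T ≤ t → γ t ∈ closedBall a r) {s t : ℝ} (hs : T ≤ s) (hst : s ≤ t) :
    ‖γ t - a‖ ≤ ‖γ s - a‖ := by
  have hr : 0 ≤ r := dist_nonneg.trans (hT T le_rfl)
  have hder : ∀ u, T ≤ u → HasDerivAt (fun u => ‖γ u - a‖ ^ 2)
      (2 * inner ℝ (γ u - a) (gradient f (γ u))) u :=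
    fun u hu => ((hγ u hu).sub_const a).norm_sq
  have hanti : AntitoneOn (fun u => ‖γ u - a‖ ^ 2) (Icc s t) := by
    refine antitoneOn_of_deriv_nonpos (convex_Icc s t)
      (fun u hu => (hder u (hs.trans hu.1)).continuousAt.continuousWithinAt)
      (fun u hu => (hder u (hs.trans (interior_subset hu).1)).differentiableAt.differentiableWithinAt)
      fun u hu => ?_
    have hu' : T ≤ u := hs.trans (interior_subset hu).1
    rw [(hder u hu').deriv, real_inner_comm]
    have h1 := hmono _ (hT u hu') a (mem_closedBall_self hr)
    rw [ha, sub_zero] at h1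
    nlinarith [mul_nonneg hm (sq_nonneg ‖γ u - a‖)]
  exact le_of_sq_le_sq (hanti (left_mem_Icc.2 hst) (right_mem_Icc.2 hst) hst) (norm_nonneg _)

/-- A preconnected set meeting a ball but not its boundary sphere stays inside the ball. -/
theorem IsPreconnected.subset_ball_of_disjoint_sphere {X : Type*} [PseudoMetricSpace X] {S : Set X}
    (hS : IsPreconnected S) {a y : X} {ρ : ℝ} (hy : y ∈ S) (hyρ : y ∈ ball a ρ)
    (hd : ∀ z ∈ S, dist z a ≠ ρ) : S ⊆ ball a ρ := by
  intro z hz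
  by_contra hzρ
  rw [mem_ball, not_lt] at hzρ
  obtain ⟨w, hw, hwρ⟩ := hS.intermediate_value hy hz
    (f := fun z => dist z a) (by fun_prop) ⟨le_of_lt hyρ, hzρ⟩
  exact hd w hw hwρ

/-- A flow line through a critical point is constant. -/
theorem gradientFlow_eq_of_gradient_eq_zero {M : ℝ} (hM : 0 ≤ M)
    (hL : ∀ x y, ‖gradient f x - gradient f y‖ ≤ M * ‖x - y‖) {γ : ℝ → E}
    (hγ : ∀ t, 0 ≤ t → HasDerivAt γ (gradient f (γ t)) t) {t₀ : ℝ} (ht₀ : 0 ≤ t₀)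
    (h0 : gradient f (γ t₀) = 0) {t : ℝ} (ht : 0 ≤ t) : γ t = γ t₀ := by
  have hLip : LipschitzWith ⟨M, hM⟩ (gradient f) :=
    LipschitzWith.of_dist_le_mul fun x y => by rw [dist_eq_norm, dist_eq_norm]; exact hL x y
  have hconst : ∀ s, HasDerivAt (fun _ : ℝ => γ t₀) (gradient f (γ t₀)) s := fun s => by
    rw [h0]; exact hasDerivAt_const _ _
  rcases le_total t t₀ with h | h
  · exact ODE_solution_unique_of_mem_Icc_left (v := fun _ => gradient f) (s := fun _ => univ)
      (a := 0) (b := t₀) (f := γ) (g := fun _ => γ t₀) (fun _ _ => hLip.lipschitzOnWith)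
      (fun s hs => (hγ s hs.1).continuousAt.continuousWithinAt)
      (fun s hs => (hγ s hs.1.le).hasDerivWithinAt) (fun _ _ => mem_univ _) continuousOn_const
      (fun s _ => (hconst s).hasDerivWithinAt) (fun _ _ => mem_univ _) rfl ⟨ht, h⟩
  · exact ODE_solution_unique_of_mem_Icc_right (v := fun _ => gradient f) (s := fun _ => univ)
      (a := t₀) (b := t) (f := γ) (g := fun _ => γ t₀) (fun _ _ => hLip.lipschitzOnWith)
      (fun s hs => (hγ s (ht₀.trans hs.1)).continuousAt.continuousWithinAt)
      (fun s hs => (hγ s (ht₀.trans hs.1)).hasDerivWithinAt) (fun _ _ => mem_univ _)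
      continuousOn_const (fun s _ => (hconst s).hasDerivWithinAt) (fun _ _ => mem_univ _) rfl
      ⟨h, le_rfl⟩

end StronglyConcave

section Tracking

variable {E : Type*} [NormedAddCommGroup E] [InnerProductSpace ℝ E] [CompleteSpace E]

/-- Quantitative data on a gradient flow line `γ` converging to a non-degenerate maximum `a`:
the gradient is `M`-Lipschitz, bounded by `G`, strongly monotone with constant `m` on the ball of
radius `r` around `a`, at least `c` in norm along `γ` before time `T`, and `γ` stays in the ball of
radius `r / 4` after time `T`. -/
structure IsTameFlow (f : E → ℝ) (a : E) (γ : ℝ → E) (M G m r T c : ℝ) : Prop where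
  contDiff : ContDiff ℝ 1 f
  M_pos : 0 < M
  lipschitz : ∀ x y, ‖gradient f x - gradient f y‖ ≤ M * ‖x - y‖
  bounded : ∀ x, ‖gradient f x‖ ≤ G
  critical : gradient f a = 0
  m_pos : 0 < m
  r_pos : 0 < r
  monotone : ∀ x ∈ closedBall a r, ∀ y ∈ closedBall a r,
    inner ℝ (gradient f x - gradient f y) (x - y) ≤ -m * ‖x - y‖ ^ 2
  flow : ∀ t, 0 ≤ t → HasDerivAt γ (gradient f (γ t)) t
  T_nonneg : 0 ≤ T
  c_pos : 0 < c
  far : ∀ t, 0 ≤ t → t < T → c ≤ ‖gradient f (γ t)‖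
  near : ∀ t, T ≤ t → ‖γ t - a‖ ≤ r / 4

variable {f : E → ℝ} {a : E} {γ : ℝ → E} {M G m r T c : ℝ}

namespace IsTameFlow

theorem norm_sub_antitone (H : IsTameFlow f a γ M G m r T c) {s t : ℝ} (hs : T ≤ s)
    (hst : s ≤ t) : ‖γ t - a‖ ≤ ‖γ s - a‖ :=
  norm_gradientFlow_sub_antitone H.critical H.m_pos.le H.monotone
    (fun t ht => H.flow t (H.T_nonneg.trans ht))
    (fun t ht => by
      rw [mem_closedBall, dist_eq_norm]; linarith [H.near t ht, H.r_pos]) hs hst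

theorem far_step (H : IsTameFlow f a γ M G m r T c) {τ η : ℝ} {q : E} (hη : 0 < η) (hτ : 0 ≤ τ)
    (hτT : τ < T) (he : M * ‖q - γ τ‖ ≤ c / 2) (hs : 64 * M * η ≤ c ^ 2) :
    0 < ‖gradient f q‖ ∧ 16 * M * η ≤ ‖gradient f q‖ ^ 2 ∧
    ∀ p, f p = f q + η → dist q p = infDist q {y | f y = f q + η} →
      dist q p ≤ 4 / c * η ∧ p ∈ connectedComponentIn {y | f q ≤ f y} q ∧
      ∃ h, 0 ≤ h ∧ h ≤ 16 / c ^ 2 * η ∧ M * h ≤ 1 / 2 ∧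
        (∀ t ∈ Icc τ (τ + h), ‖γ t - γ (τ + h)‖ ≤ G * h) ∧
        (1 - M * h) * ‖p - γ (τ + h)‖ ≤ ‖q - γ τ‖ + h * (M * (G * h)) := by
  have hc := H.c_pos
  have hM := H.M_pos
  have hg : c / 2 ≤ ‖gradient f q‖ := by
    have h1 := H.far τ hτ hτT
    have h2 := norm_sub_norm_le (gradient f (γ τ)) (gradient f q)
    have h3 := H.lipschitz (γ τ) q
    rw [norm_sub_rev (γ τ) q] at h3
    linarith
  have hg0 : 0 < ‖gradient f q‖ := by linarith
  have hg2 : c ^ 2 / 4 ≤ ‖gradient f q‖ ^ 2 := by nlinarith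
  have hs' : 16 * M * η ≤ ‖gradient f q‖ ^ 2 := by linarith
  refine ⟨hg0, hs', fun p hp hd => ?_⟩
  obtain ⟨hδ, ⟨h, h0, hle, hh⟩, hconn⟩ :=
    level_projection_step H.contDiff hM.le H.lipschitz hη hg0 hs' hp hd
  have hle' : h ≤ 16 / c ^ 2 * η := by
    refine hle.trans ?_
    rw [div_le_iff₀ (by positivity)]
    calc 4 * η = 16 / c ^ 2 * η * (c ^ 2 / 4) := by field_simp; ring
      _ ≤ _ := by gcongr
  have hMh : M * h ≤ 1 / 2 := by
    rw [le_div_iff₀ (by positivity)] at hle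
    have : M * h * ‖gradient f q‖ ^ 2 ≤ 1 / 2 * ‖gradient f q‖ ^ 2 := by nlinarith
    exact le_of_mul_le_mul_right this (by positivity)
  refine ⟨hδ.trans ?_, hconn, h, h0, hle', hMh, ?_⟩
  · rw [div_le_iff₀ hg0]
    calc 2 * η = 4 / c * η * (c / 2) := by field_simp; ring
      _ ≤ _ := by gcongr
  · have := implicit_euler_error hM.le H.lipschitz (κ := -M) (N := G) h0
      (fun t ht => H.flow t (hτ.trans ht.1)) (fun t _ => H.bounded _) hh (by
        refine (real_inner_le_norm _ _).trans ?_
        have := H.lipschitz p (γ (τ + h))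
        nlinarith [norm_nonneg (p - γ (τ + h))])
    simpa [sub_eq_add_neg] using this

theorem near_step (H : IsTameFlow f a γ M G m r T c) {τ η ε A B : ℝ} {q : E} (hε : 0 < ε)
    (hη : η = ε ^ 2) (hτT : T ≤ τ) (hA1 : 1 ≤ A) (hA2 : 16 * M ≤ A * m ^ 2)
    (hA3 : 8 * M ^ 2 ≤ A * m ^ 3) (hB : 1 ≤ B) (hBr : B * ε ≤ r / 4) (hmr : 2 / m * ε ≤ r / 4)
    (he : ‖q - γ τ‖ ≤ B * ε) (hq : A * ε < ‖q - a‖) :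
    0 < ‖gradient f q‖ ∧ 16 * M * η ≤ ‖gradient f q‖ ^ 2 ∧
    ∀ p, f p = f q + η → dist q p = infDist q {y | f y = f q + η} →
      dist q p ≤ 2 / m * ε ∧ p ∈ connectedComponentIn {y | f q ≤ f y} q ∧
      ∃ h, 0 ≤ h ∧ (∀ t ∈ Icc τ (τ + h), ‖γ t - γ (τ + h)‖ ≤ m / M * B * ε) ∧
        ‖p - γ (τ + h)‖ ≤ B * ε := by
  have hm := H.m_pos
  have hM := H.M_pos
  have hr := H.r_pos
  have hτ0 : 0 ≤ τ := H.T_nonneg.trans hτT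
  have hAε : 0 < A * ε := by positivity
  set R := ‖q - a‖ with hR
  have hR0 : 0 < R := hAε.trans hq
  have hRr : R ≤ r / 2 := by
    have := norm_sub_le_norm_sub_add_norm_sub q (γ τ) a
    linarith [H.near τ hτT]
  set g := ‖gradient f q‖ with hg
  have hgR : m * R ≤ g := mul_norm_sub_le_norm_gradient H.critical hr.le H.monotone
    (by rw [mem_closedBall, dist_eq_norm]; linarith)
  have hg0 : 0 < g := (by positivity : 0 < m * R).trans_le hgR
  have hη0 : 0 < η := by rw [hη]; positivity
  have hεR : ε ≤ R := by nlinarith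
  have hAη : A * η ≤ R * ε := by rw [hη]; nlinarith
  have hAR : A * η ≤ R ^ 2 := by nlinarith
  have hg2 : m ^ 2 * R ^ 2 ≤ g ^ 2 := by rw [← mul_pow]; gcongr
  have hs' : 16 * M * η ≤ g ^ 2 := by
    calc 16 * M * η ≤ A * m ^ 2 * η := by gcongr
      _ = m ^ 2 * (A * η) := by ring
      _ ≤ m ^ 2 * R ^ 2 := by gcongr
      _ ≤ _ := hg2
  refine ⟨hg0, hs', fun p hp hd => ?_⟩
  obtain ⟨hδ, ⟨h, h0, hle, hh⟩, hconn⟩ :=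
    level_projection_step H.contDiff hM.le H.lipschitz hη0 hg0 hs' hp hd
  have hδ' : dist q p ≤ 2 / m * ε := by
    refine hδ.trans ?_
    rw [div_le_iff₀ hg0]
    calc 2 * η = 2 / m * ε * (m * ε) := by rw [hη]; field_simp
      _ ≤ 2 / m * ε * g := by gcongr; nlinarith
  refine ⟨hδ', hconn, h, h0, ?_⟩
  have hhR : h * (m ^ 2 * R ^ 2) ≤ 4 * η := by
    rw [le_div_iff₀ (by positivity)] at hle
    exact (mul_le_mul_of_nonneg_left hg2 h0).trans hle
  have hhR1 : A * m ^ 2 * (h * R) ≤ 4 * ε := by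
    refine le_of_mul_le_mul_right ?_ hR0
    calc A * m ^ 2 * (h * R) * R = A * (h * (m ^ 2 * R ^ 2)) := by ring
      _ ≤ A * (4 * η) := by gcongr
      _ = 4 * (A * η) := by ring
      _ ≤ 4 * (R * ε) := by gcongr
      _ = 4 * ε * R := by ring
  have hhA : A * m ^ 2 * h ≤ 4 := by
    refine le_of_mul_le_mul_right ?_ (by positivity : 0 < R ^ 2)
    calc A * m ^ 2 * h * R ^ 2 = A * (h * (m ^ 2 * R ^ 2)) := by ring
      _ ≤ A * (4 * η) := by gcongr
      _ = 4 * (A * η) := by ring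
      _ ≤ 4 * R ^ 2 := by gcongr
  have hγτ : ‖γ τ - a‖ ≤ R + B * ε := by
    have := norm_sub_le_norm_sub_add_norm_sub (γ τ) q a
    rw [norm_sub_rev (γ τ) q] at this
    linarith
  have hN : ∀ t ∈ Icc τ (τ + h), ‖gradient f (γ t)‖ ≤ M * (R + B * ε) := by
    intro t ht
    have h1 := H.lipschitz (γ t) a
    rw [H.critical, sub_zero] at h1
    refine h1.trans ?_
    gcongr
    exact (H.norm_sub_antitone hτT ht.1).trans hγτ
  have hstep : M * (M * (R + B * ε) * h) ≤ m * (B * ε) := by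
    refine le_of_mul_le_mul_left ?_ (by positivity : 0 < A * m ^ 2)
    calc A * m ^ 2 * (M * (M * (R + B * ε) * h))
        = M ^ 2 * (A * m ^ 2 * (h * R) + A * m ^ 2 * h * (B * ε)) := by ring
      _ ≤ M ^ 2 * (4 * ε + 4 * (B * ε)) := by gcongr
      _ ≤ M ^ 2 * (8 * (B * ε)) := by gcongr; linarith [le_mul_of_one_le_left hε.le hB]
      _ = 8 * M ^ 2 * (B * ε) := by ring
      _ ≤ A * m ^ 3 * (B * ε) := by gcongr
      _ = _ := by ring
  have hpr : p ∈ closedBall a r := by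
    rw [mem_closedBall]
    have h1 := dist_triangle p q a
    rw [dist_comm p q, dist_eq_norm q a] at h1
    linarith
  have hzr : γ (τ + h) ∈ closedBall a r := by
    rw [mem_closedBall, dist_eq_norm]
    linarith [H.near (τ + h) (by linarith)]
  obtain ⟨hdisp, herr⟩ := implicit_euler_error hM.le H.lipschitz (κ := m)
    (N := M * (R + B * ε)) h0 (fun t ht => H.flow t (hτ0.trans ht.1)) hN hh
    (H.monotone _ hpr _ hzr)
  refine ⟨fun t ht => (hdisp t ht).trans ?_, ?_⟩
  · refine le_of_mul_le_mul_left (hstep.trans_eq ?_) hM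
    field_simp
  · refine le_of_mul_le_mul_left (herr.trans ?_) (by positivity : 0 < 1 + m * h)
    have : h * (M * (M * (R + B * ε) * h)) ≤ h * (m * (B * ε)) := by gcongr
    linarith

/-- Until the neighborhood of radius `A * ε` of the maximum is reached, one step of the level
projection method with level step `ε ^ 2` exists, does not leave the current connected component,
and keeps tracking the flow line up to an error of order `ε`. -/
theorem tracking_step (H : IsTameFlow f a γ M G m r T c) {τ η ε A B c₁ : ℝ} {q : E} (hε : 0 < ε)
    (hη : η = ε ^ 2) (hA1 : 1 ≤ A) (hA2 : 16 * M ≤ A * m ^ 2)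
    (hA3 : 8 * M ^ 2 ≤ A * m ^ 3) (hc₁0 : 0 ≤ c₁) (hc₁ : 16 * G ≤ c₁ * c ^ 2) (hB1 : 1 ≤ B)
    (hB : c₁ * Real.exp (2 * M * (T + 1)) ≤ B) (hε1 : ε ≤ 1) (hBr : B * ε ≤ r / 4)
    (hmr : 2 / m * ε ≤ r / 4) (hMB : M * (B * ε) ≤ c / 2) (hcM : 64 * M * ε ≤ c ^ 2)
    (hc16 : 16 * ε ≤ c ^ 2) (hτ : 0 ≤ τ) (he : ‖q - γ τ‖ ≤ B * ε)
    (he' : τ < T → ‖q - γ τ‖ ≤ c₁ * ε * (Real.exp (2 * M * τ) - 1))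
    (hnear : ¬ (T ≤ τ ∧ ‖q - a‖ ≤ A * ε)) :
    0 < ‖gradient f q‖ ∧ 16 * M * η ≤ ‖gradient f q‖ ^ 2 ∧
    ∀ p, f p = f q + η → dist q p = infDist q {y | f y = f q + η} →
      dist q p ≤ (4 / c + 2 / m) * ε ∧ p ∈ connectedComponentIn {y | f q ≤ f y} q ∧
      ∃ τ', τ ≤ τ' ∧ (∀ t ∈ Icc τ τ', ‖γ t - γ τ'‖ ≤ (c₁ + m / M * B) * ε) ∧
        ‖p - γ τ'‖ ≤ B * ε ∧
        (τ' < T → ‖p - γ τ'‖ ≤ c₁ * ε * (Real.exp (2 * M * τ') - 1)) := by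
  have hm := H.m_pos
  have hM := H.M_pos
  have hc := H.c_pos
  have hG : 0 ≤ G := (norm_nonneg _).trans (H.bounded a)
  have hη0 : 0 < η := by rw [hη]; positivity
  have hηε : η ≤ ε := by rw [hη]; nlinarith
  rcases lt_or_ge τ T with hτT | hτT
  · obtain ⟨hg0, hs, hstep⟩ := H.far_step (q := q) hη0 hτ hτT
      ((mul_le_mul_of_nonneg_left he hM.le).trans hMB)
      ((mul_le_mul_of_nonneg_left hηε (by positivity)).trans hcM)
    refine ⟨hg0, hs, fun p hp hd => ?_⟩
    obtain ⟨hδ, hconn, h, h0, hle, hMh, hdisp, herr⟩ := hstep p hp hd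
    have hGh : G * h ≤ c₁ * ε := by
      calc G * h ≤ G * (16 / c ^ 2 * η) := by gcongr
        _ = 16 * G / c ^ 2 * η := by ring
        _ ≤ c₁ * ε := by
          gcongr
          rwa [div_le_iff₀ (by positivity)]
    have hh1 : h ≤ 1 := by
      refine hle.trans ?_
      rw [div_mul_eq_mul_div, div_le_one (by positivity)]
      linarith
    have hexp : ‖p - γ (τ + h)‖ ≤ c₁ * ε * (Real.exp (2 * M * (τ + h)) - 1) := by
      have hX : 0 < Real.exp (2 * M * τ) := Real.exp_pos _
      have hY : 2 * M * h + 1 ≤ Real.exp (2 * M * h) := Real.add_one_le_exp _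
      rw [mul_add, Real.exp_add]
      have hMh0 : 0 ≤ M * h := by positivity
      have hXY : Real.exp (2 * M * τ) ≤
          (1 - M * h) * (Real.exp (2 * M * τ) * Real.exp (2 * M * h)) := by
        have h1 : 1 ≤ (1 - M * h) * Real.exp (2 * M * h) := by
          calc (1 : ℝ) ≤ (1 - M * h) * (2 * M * h + 1) := by nlinarith
            _ ≤ _ := by gcongr; linarith
        calc Real.exp (2 * M * τ) = Real.exp (2 * M * τ) * 1 := (mul_one _).symm
          _ ≤ Real.exp (2 * M * τ) * ((1 - M * h) * Real.exp (2 * M * h)) := by gcongr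
          _ = _ := by ring
      refine le_of_mul_le_mul_left (herr.trans ?_) (by linarith : 0 < 1 - M * h)
      have h2 : h * (M * (G * h)) ≤ h * (M * (c₁ * ε)) := by gcongr
      have h3 := mul_le_mul_of_nonneg_left hXY (by positivity : 0 ≤ c₁ * ε)
      have h4 := he' hτT
      calc ‖q - γ τ‖ + h * (M * (G * h))
          ≤ c₁ * ε * (Real.exp (2 * M * τ) - 1) + h * (M * (c₁ * ε)) := add_le_add h4 h2
        _ = c₁ * ε * Real.exp (2 * M * τ) - c₁ * ε * (1 - M * h) := by ring
        _ ≤ _ := (sub_le_sub_right h3 _).trans_eq (by ring)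
    refine ⟨hδ.trans ?_, hconn, τ + h, by linarith, fun t ht => (hdisp t ht).trans
      (hGh.trans ?_), hexp.trans ?_, fun _ => hexp⟩
    · calc 4 / c * η ≤ 4 / c * ε := by gcongr
        _ ≤ _ := by gcongr; linarith [(by positivity : 0 < 2 / m)]
    · gcongr
      linarith [(by positivity : 0 < m / M * B)]
    · calc c₁ * ε * (Real.exp (2 * M * (τ + h)) - 1)
          ≤ c₁ * ε * Real.exp (2 * M * (T + 1)) := by
            gcongr
            have : Real.exp (2 * M * (τ + h)) ≤ Real.exp (2 * M * (T + 1)) := by gcongr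
            linarith
        _ = c₁ * Real.exp (2 * M * (T + 1)) * ε := by ring
        _ ≤ B * ε := by gcongr
  · obtain ⟨hg0, hs, hstep⟩ := H.near_step hε hη hτT hA1 hA2 hA3 hB1 hBr hmr he
      (by by_contra! hle; exact hnear ⟨hτT, hle⟩)
    refine ⟨hg0, hs, fun p hp hd => ?_⟩
    obtain ⟨hδ, hconn, h, h0, hdisp, herr⟩ := hstep p hp hd
    refine ⟨hδ.trans ?_, hconn, τ + h, by linarith, fun t ht => (hdisp t ht).trans ?_, herr,
      fun hlt => absurd hlt (by linarith)⟩
    · gcongr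
      linarith [(by positivity : 0 < 4 / c)]
    · gcongr
      linarith

/-- Close to the maximum, connected components of upper level sets are small. -/
theorem connectedComponentIn_subset_ball (H : IsTameFlow f a γ M G m r T c) {A' A ε l : ℝ}
    {y : E} (hA : 2 * M * A ^ 2 < m * A' ^ 2) (hAr : A' * ε ≤ r) (hε : 0 < ε)
    (hl : f a - M * (A * ε) ^ 2 ≤ l) (hy : y ∈ ball a (A' * ε)) :
    connectedComponentIn {z | l ≤ f z} y ⊆ ball a (A' * ε) := by
  intro z hz
  have hyF : y ∈ {z | l ≤ f z} := connectedComponentIn_nonempty_iff.1 ⟨z, hz⟩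
  refine isPreconnected_connectedComponentIn.subset_ball_of_disjoint_sphere
    (mem_connectedComponentIn hyF) hy (fun w hw hwd => ?_) hz
  have h1 : w ∈ {z | l ≤ f z} := connectedComponentIn_subset _ _ hw
  rw [mem_ofPred_eq] at h1
  have h2 := le_sub_sq_of_strong_monotone_gradient (H.contDiff.differentiable one_ne_zero)
    H.critical H.monotone (x := w) (by rw [mem_closedBall, hwd]; exact hAr)
  rw [← dist_eq_norm, hwd] at h2
  have h3 : 2 * M * A ^ 2 * ε ^ 2 < m * A' ^ 2 * ε ^ 2 := by gcongr
  nlinarith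

end IsTameFlow

end Tracking

theorem mem_polyline_succ {q : ℕ → EuclideanSpace ℝ (Fin d)} {k : ℕ}
    {y : EuclideanSpace ℝ (Fin d)} :
    y ∈ Polyline q (k + 1) ↔ y ∈ Polyline q k ∨ y ∈ segment ℝ (q k) (q (k + 1)) := by
  simp only [Polyline, mem_union, mem_iUnion, Finset.mem_range, exists_prop, Nat.lt_succ_iff_lt_or_eq,
    or_and_right, exists_or, exists_eq_left, or_assoc]

theorem polyline_mono {q : ℕ → EuclideanSpace ℝ (Fin d)} {j k : ℕ} (h : j ≤ k) :
    Polyline q j ⊆ Polyline q k := by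
  induction h with
  | refl => exact Subset.rfl
  | step _ ih => exact fun y hy => mem_polyline_succ.2 (Or.inl (ih hy))

theorem mem_polyline_self (q : ℕ → EuclideanSpace ℝ (Fin d)) (k : ℕ) : q k ∈ Polyline q k := by
  cases k with
  | zero => simp [Polyline]
  | succ k => exact mem_polyline_succ.2 (Or.inr (right_mem_segment ℝ _ _))

variable {f : EuclideanSpace ℝ (Fin d) → ℝ}

theorem Alg1Run.apply_eq {x r : EuclideanSpace ℝ (Fin d)} {η : ℝ}
    {q : ℕ → EuclideanSpace ℝ (Fin d)} {K : ℕ} (h : Alg1Run f x η q K r) {k : ℕ} (hk : k ≤ K) :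
    f (q k) = f x + k * η := by
  cases k with
  | zero => simp [h.1]
  | succ k =>
    have := (h.2.1 k hk).1.1
    rw [mem_ofPred_eq] at this
    rw [this]; push_cast; ring

theorem Alg1Run.proj {x r : EuclideanSpace ℝ (Fin d)} {η : ℝ}
    {q : ℕ → EuclideanSpace ℝ (Fin d)} {K : ℕ} (h : Alg1Run f x η q K r) {k : ℕ} (hk : k < K) :
    f (q (k + 1)) = f (q k) + η ∧
      dist (q k) (q (k + 1)) = infDist (q k) {y | f y = f (q k) + η} := by
  have hlev : f x + ((k : ℝ) + 1) * η = f (q k) + η := by rw [h.apply_eq hk.le]; ring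
  obtain ⟨h1, h2⟩ := (h.2.1 k hk).1
  rw [hlev] at h1 h2
  exact ⟨h1, h2⟩

/-- The run cannot stop at a point where every projection on the next (nonempty) level set stays
in the current connected component. -/
theorem Alg1Run.not_terminates {x r : EuclideanSpace ℝ (Fin d)} {η : ℝ}
    {q : ℕ → EuclideanSpace ℝ (Fin d)} {K : ℕ} (h : Alg1Run f x η q K r)
    (hex : ∃ y, f y = f (q K) + η)
    (hconn : ∀ p, f p = f (q K) + η → dist (q K) p = infDist (q K) {y | f y = f (q K) + η} →
      p ∈ connectedComponentIn {y | f (q K) ≤ f y} (q K)) : False := by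
  have hlev : f x + ((K : ℝ) + 1) * η = f (q K) + η := by rw [h.apply_eq le_rfl]; ring
  obtain ⟨y, hy⟩ := hex
  have hnear := h.2.2.1
  rw [hlev, ← h.apply_eq le_rfl] at hnear
  rcases hnear with hemp | ⟨p, ⟨h1, h2⟩, hp⟩
  · exact (hemp ▸ (show y ∈ {y | f y = f (q K) + η} from hy) : y ∈ (∅ : Set _))
  · exact hp (hconn p h1 h2)

/-- Once a run is close to the maximum, it stays close to it. -/
theorem Alg1Run.polyline_near {a x r₀ : EuclideanSpace ℝ (Fin d)}
    {γ : ℝ → EuclideanSpace ℝ (Fin d)} {M G m r T c η ε A A' : ℝ}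
    (H : IsTameFlow f a γ M G m r T c)
    {q : ℕ → EuclideanSpace ℝ (Fin d)} {K : ℕ} (h : Alg1Run f x η q K r₀) (hη : 0 < η)
    (hε : 0 < ε) (hA : 2 * M * A ^ 2 < m * A' ^ 2) (hAA' : A < A') (hAr : A' * ε ≤ r)
    {k : ℕ} (hk : k ≤ K) (hq : ‖q k - a‖ ≤ A * ε) :
    ∀ y ∈ Polyline q K, y ∈ Polyline q k ∨ y ∈ ball a (A' * ε) := by
  have hlow : f a - M * (A * ε) ^ 2 ≤ f (q k) := by
    have h1 := (abs_le.1 (abs_sub_sub_inner_gradient_le (H.contDiff.differentiable one_ne_zero)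
      H.M_pos.le H.lipschitz a (q k))).1
    rw [H.critical, inner_zero_left, sub_zero] at h1
    have h2 : M * ‖q k - a‖ ^ 2 ≤ M * (A * ε) ^ 2 := by
      have := H.M_pos
      gcongr
    linarith
  have key : ∀ j, k ≤ j → j ≤ K →
      q j ∈ ball a (A' * ε) ∧ ∀ y ∈ Polyline q j, y ∈ Polyline q k ∨ y ∈ ball a (A' * ε) := by
    intro j hkj
    induction j, hkj using Nat.le_induction with
    | base =>
      refine fun _ => ⟨?_, fun y hy => Or.inl hy⟩
      rw [mem_ball, dist_eq_norm]
      exact hq.trans_lt (by gcongr)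
    | succ j hkj ih =>
      intro hjK
      obtain ⟨hj, hpoly⟩ := ih (by omega)
      have hlev : f a - M * (A * ε) ^ 2 ≤ f x + j * η := by
        refine hlow.trans ?_
        rw [h.apply_eq hk]
        gcongr
      have hj' : q (j + 1) ∈ ball a (A' * ε) :=
        H.connectedComponentIn_subset_ball hA hAr hε hlev hj (h.2.1 j hjK).2
      refine ⟨hj', fun y hy => ?_⟩
      rcases mem_polyline_succ.1 hy with hy | hy
      · exact hpoly y hy
      · exact Or.inr ((convex_ball a _).segment_subset hj hj' hy)
  exact (key K hk le_rfl).2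

theorem exists_isTameFlow (hf : StandingAssumptions f) {x a : EuclideanSpace ℝ (Fin d)}
    (hmode : IsLocalMax f a) {γ : ℝ → EuclideanSpace ℝ (Fin d)} (hγ : IsGradientFlow f x γ)
    (hlim : Tendsto γ atTop (𝓝 a)) :
    ∃ M G m r T c, IsTameFlow f a γ M G m r T c := by
  obtain ⟨hC2, -, ⟨G, hG⟩, ⟨L, hL⟩, -, hMorse⟩ := hf
  have hcrit := gradient_eq_zero_of_isLocalMax hmode
  obtain ⟨m, hm, r, hr, hmono⟩ := exists_strong_monotone_gradient hC2 hmode (hMorse a hcrit).1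
  set M := max L 1 with hMdef
  have hM : 0 < M := lt_max_of_lt_right one_pos
  have hLip : ∀ x y, ‖gradient f x - gradient f y‖ ≤ M * ‖x - y‖ := fun x y =>
    convex_univ.norm_image_sub_le_of_norm_fderiv_le (𝕜 := ℝ)
      (fun z _ => (contDiff_gradient hC2).differentiable one_ne_zero z)
      (fun z _ => (hL z).trans (le_max_left _ _)) (mem_univ y) (mem_univ x)
  obtain ⟨T₀, hT₀⟩ := eventually_atTop.1 (hlim.eventually (closedBall_mem_nhds a
    (by positivity : 0 < r / 4)))
  have hnear : ∀ t, T₀ ≤ t → ‖γ t - a‖ ≤ r / 4 := fun t ht => by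
    simpa [dist_eq_norm] using hT₀ t ht
  by_cases h0 : ∃ t₀, 0 ≤ t₀ ∧ gradient f (γ t₀) = 0
  · obtain ⟨t₀, ht₀, h0⟩ := h0
    have hconst : ∀ t, 0 ≤ t → γ t = γ t₀ := fun t ht =>
      gradientFlow_eq_of_gradient_eq_zero hM.le hLip hγ.2 ht₀ h0 ht
    refine ⟨M, G, m, r, 0, 1, ⟨hC2.of_le (by norm_num), hM, hLip, hG, hcrit, hm, hr, hmono, hγ.2,
      le_rfl, one_pos, fun t h1 h2 => absurd h1 (not_le.2 h2), fun t ht => ?_⟩⟩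
    rw [hconst t ht, ← hconst (max T₀ 0) (le_max_right _ _)]
    exact hnear _ (le_max_left _ _)
  · push Not at h0
    have hcont : ContinuousOn (fun t => ‖gradient f (γ t)‖) (Icc 0 (max T₀ 0)) := fun t ht =>
      ((contDiff_gradient hC2).continuous.continuousAt.comp
        (hγ.2 t ht.1).continuousAt).norm.continuousWithinAt
    obtain ⟨s, hs, hmin⟩ := isCompact_Icc.exists_isMinOn
      (nonempty_Icc.2 (le_max_right T₀ 0)) hcont
    exact ⟨M, G, m, r, max T₀ 0, ‖gradient f (γ s)‖, ⟨hC2.of_le (by norm_num), hM, hLip, hG, hcrit,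
      hm, hr, hmono, hγ.2, le_max_right _ _, norm_pos_iff.2 (h0 s hs.1),
      fun t h1 h2 => hmin ⟨h1, h2.le⟩, fun t ht => hnear t ((le_max_left _ _).trans ht)⟩⟩

/-- the Hausdorff distance between the polygonal line produced by Algorithm 1 with
level step `η` and the gradient ascent line is `O(√η)`. -/
theorem alg1_hausdorff_rate (f : EuclideanSpace ℝ (Fin d) → ℝ)
    (hf : StandingAssumptions f) (x xstar : EuclideanSpace ℝ (Fin d))
    (hmode : IsLocalMax f xstar) (γ : ℝ → EuclideanSpace ℝ (Fin d))
    (hγ : IsGradientFlow f x γ) (hlim : Tendsto γ atTop (nhds xstar)) :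
    ∃ C > 0, ∃ η₀ > 0, ∀ η : ℝ, 0 < η → η ≤ η₀ →
      ∀ q K r, Alg1Run f x η q K r →
        hausdorffDist (Polyline q K) (γ '' Ici 0 ∪ {xstar}) ≤ C * Real.sqrt η := by
  obtain ⟨M, G, m, r, T, c, H⟩ := exists_isTameFlow hf hmode hγ hlim
  have hm := H.m_pos
  have hM := H.M_pos
  have hc := H.c_pos
  have hr := H.r_pos
  have hG : 0 ≤ G := (norm_nonneg _).trans (H.bounded x)
  obtain ⟨c₁, hc₁0, hc₁⟩ : ∃ c₁, 0 ≤ c₁ ∧ 16 * G ≤ c₁ * c ^ 2 :=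
    ⟨16 * G / c ^ 2, by positivity, by rw [div_mul_cancel₀ _ (by positivity)]⟩
  obtain ⟨B, hB1, hB⟩ : ∃ B, 1 ≤ B ∧ c₁ * Real.exp (2 * M * (T + 1)) ≤ B :=
    ⟨_, le_max_left _ _, le_max_right _ _⟩
  obtain ⟨A, hA1, hA2, hA3⟩ : ∃ A, 1 ≤ A ∧ 16 * M ≤ A * m ^ 2 ∧ 8 * M ^ 2 ≤ A * m ^ 3 := by
    refine ⟨1 + 16 * M / m ^ 2 + 8 * M ^ 2 / m ^ 3, ?_, ?_, ?_⟩
    · linarith [(by positivity : 0 ≤ 16 * M / m ^ 2), (by positivity : 0 ≤ 8 * M ^ 2 / m ^ 3)]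
    · rw [← div_le_iff₀ (by positivity)]
      linarith [(by positivity : 0 ≤ 8 * M ^ 2 / m ^ 3)]
    · rw [← div_le_iff₀ (by positivity)]
      linarith [(by positivity : 0 ≤ 16 * M / m ^ 2)]
  obtain ⟨A', hAA', hA'⟩ : ∃ A', A < A' ∧ 2 * M * A ^ 2 < m * A' ^ 2 := by
    refine ⟨A * (1 + 2 * (M / m)), ?_, ?_⟩
    · exact lt_mul_of_one_lt_right (by linarith) (by linarith [(by positivity : 0 < M / m)])
    · have h1 : M = m * (M / m) := by field_simp
      have h2 : 0 < M / m := by positivity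
      calc 2 * M * A ^ 2 = m * A ^ 2 * (2 * (M / m)) := by field_simp
        _ < m * A ^ 2 * (1 + 2 * (M / m)) ^ 2 := by gcongr; nlinarith
        _ = _ := by ring
  set S := 4 / c + 2 / m with hS
  set D₁ := c₁ + m / M * B with hD₁
  have hS0 : 0 ≤ S := by positivity
  have hD₁0 : 0 ≤ D₁ := by positivity
  have hA0 : 0 ≤ A := by linarith
  have hA'0 : 0 ≤ A' := by linarith
  set C := B + S + D₁ + 2 * A + A' with hC
  have hsmall : ∀ u v : ℝ, 0 < v → ∀ᶠ ε : ℝ in 𝓝[>] 0, u * ε ≤ v := by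
    intro u v hv
    have : Tendsto (fun ε : ℝ => u * ε) (𝓝 0) (𝓝 0) := by
      simpa using (continuous_const_mul u).tendsto (0 : ℝ)
    exact ((this.eventually_lt_const hv).mono fun _ h => h.le).filter_mono nhdsWithin_le_nhds
  have hev : ∀ᶠ ε : ℝ in 𝓝[>] 0, 1 * ε ≤ 1 ∧ B * ε ≤ r / 4 ∧ 2 / m * ε ≤ r / 4 ∧
      M * B * ε ≤ c / 2 ∧ 64 * M * ε ≤ c ^ 2 ∧ 16 * ε ≤ c ^ 2 ∧ A' * ε ≤ r := by
    filter_upwards [hsmall 1 1 one_pos, hsmall B (r / 4) (by positivity),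
      hsmall (2 / m) (r / 4) (by positivity), hsmall (M * B) (c / 2) (by positivity),
      hsmall (64 * M) (c ^ 2) (by positivity), hsmall 16 (c ^ 2) (by positivity),
      hsmall A' r hr] with ε h1 h2 h3 h4 h5 h6 h7 using ⟨h1, h2, h3, h4, h5, h6, h7⟩
  have hsqrt : Tendsto Real.sqrt (𝓝[>] 0) (𝓝[>] 0) := by
    refine tendsto_nhdsWithin_iff.2 ⟨?_, ?_⟩
    · have := Real.continuous_sqrt.tendsto 0
      rw [Real.sqrt_zero] at this
      exact this.mono_left nhdsWithin_le_nhds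
    · filter_upwards [self_mem_nhdsWithin] with η hη using Real.sqrt_pos.2 hη
  obtain ⟨η₀, hη₀, hsub⟩ := (mem_nhdsGT_iff_exists_Ioc_subset).1 (hsqrt.eventually hev)
  refine ⟨C, by positivity, η₀, hη₀, fun η hη hηle q K r₀ hrun => ?_⟩
  obtain ⟨hε1, hBr, hmr, hMB, hcM, hc16, hA'r⟩ := hsub ⟨hη, hηle⟩
  have hε : 0 < Real.sqrt η := Real.sqrt_pos.2 hη
  have hηε : η = Real.sqrt η ^ 2 := (Real.sq_sqrt hη.le).symm
  set ε := Real.sqrt η with hεdef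
  rw [one_mul] at hε1
  rw [mul_assoc] at hMB
  have step := fun (p : EuclideanSpace ℝ (Fin d)) (τ : ℝ) => H.tracking_step (q := p) (τ := τ) hε
    hηε hA1 hA2 hA3 hc₁0 hc₁ hB1 hB hε1 hBr hmr hMB hcM hc16
  let tracked : ℕ → ℝ → Prop := fun k τ => 0 ≤ τ ∧ ‖q k - γ τ‖ ≤ B * ε ∧
    (τ < T → ‖q k - γ τ‖ ≤ c₁ * ε * (Real.exp (2 * M * τ) - 1)) ∧
    (∀ y ∈ Polyline q k, ∃ t, 0 ≤ t ∧ dist y (γ t) ≤ (B + S) * ε) ∧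
    (∀ t ∈ Icc 0 τ, ∃ y ∈ Polyline q k, dist (γ t) y ≤ (B + D₁) * ε)
  have hind : ∀ k ≤ K, (∃ j ≤ K, ∃ τ, tracked j τ ∧ T ≤ τ ∧ ‖q j - xstar‖ ≤ A * ε) ∨
      ∃ τ, tracked k τ := by
    intro k
    induction k with
    | zero =>
      have hq0 : q 0 = γ 0 := by rw [hrun.1, hγ.1]
      refine fun _ => Or.inr ⟨0, le_rfl, ?_, fun _ => ?_, fun y hy => ⟨0, le_rfl, ?_⟩,
        fun t ht => ⟨q 0, mem_polyline_self q 0, ?_⟩⟩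
      · rw [hq0, sub_self, norm_zero]; positivity
      · rw [hq0, sub_self, norm_zero]; simp
      · have : y = γ 0 := by simpa [Polyline, hq0] using hy
        rw [this, dist_self]; positivity
      · rw [le_antisymm ht.2 ht.1, hq0, dist_self]; positivity
    | succ k ih =>
      intro hk
      rcases ih (by omega) with hnear | ⟨τ, htr⟩
      · exact Or.inl hnear
      by_cases hnear : T ≤ τ ∧ ‖q k - xstar‖ ≤ A * ε
      · exact Or.inl ⟨k, by omega, τ, htr, hnear⟩
      right
      obtain ⟨hτ, he, he', hp1, hp2⟩ := htr
      obtain ⟨-, -, hstep⟩ := step (q k) τ hτ he he' hnear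
      obtain ⟨hproj, hdist⟩ := hrun.proj hk
      obtain ⟨hδ, -, τ', hττ', hdisp, herr, herr'⟩ := hstep _ hproj hdist
      refine ⟨τ', hτ.trans hττ', herr, herr', fun y hy => ?_, fun t ht => ?_⟩
      · rcases mem_polyline_succ.1 hy with hy | hy
        · exact hp1 y hy
        · refine ⟨τ, hτ, ?_⟩
          have h1 : dist y (q k) ≤ S * ε := by
            have : y ∈ closedBall (q k) (S * ε) :=
              (convex_closedBall _ _).segment_subset (mem_closedBall_self (by positivity))
                (by rw [mem_closedBall, dist_comm]; exact hδ) hy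
            exact this
          calc dist y (γ τ) ≤ dist y (q k) + dist (q k) (γ τ) := dist_triangle _ _ _
            _ ≤ S * ε + B * ε := add_le_add h1 (by rw [dist_eq_norm]; exact he)
            _ = _ := by ring
      · rcases le_total t τ with htτ | htτ
        · obtain ⟨y, hy, hty⟩ := hp2 t ⟨ht.1, htτ⟩
          exact ⟨y, mem_polyline_succ.2 (Or.inl hy), hty⟩
        · refine ⟨q (k + 1), mem_polyline_self q (k + 1), ?_⟩
          calc dist (γ t) (q (k + 1)) ≤ dist (γ t) (γ τ') + dist (γ τ') (q (k + 1)) :=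
                dist_triangle _ _ _
            _ ≤ D₁ * ε + B * ε := add_le_add (by rw [dist_eq_norm]; exact hdisp t ⟨htτ, ht.2⟩)
                (by rw [dist_comm, dist_eq_norm]; exact herr)
            _ = _ := by ring
  obtain ⟨k, hkK, τ, ⟨hτ, he, -, hp1, hp2⟩, hτT, hqk⟩ :
      ∃ j ≤ K, ∃ τ, tracked j τ ∧ T ≤ τ ∧ ‖q j - xstar‖ ≤ A * ε := by
    rcases hind K le_rfl with hnear | ⟨τ, htr⟩
    · exact hnear
    by_cases hnear : T ≤ τ ∧ ‖q K - xstar‖ ≤ A * ε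
    · exact ⟨K, le_rfl, τ, htr, hnear⟩
    exfalso
    obtain ⟨hg0, hs, hstep⟩ := step (q K) τ htr.1 htr.2.1 htr.2.2.1 hnear
    obtain ⟨y, hy, -⟩ := exists_level_eq_dist_le (H.contDiff.differentiable one_ne_zero) hM.le
      H.lipschitz hη hg0 hs
    exact hrun.not_terminates ⟨y, hy⟩ fun p hp hd => (hstep p hp hd).2.1
  have hpolyK := polyline_mono (q := q) hkK
  have hle : ∀ u : ℝ, u ≤ C → u * ε ≤ C * ε := fun u hu => by gcongr
  refine hausdorffDist_le_of_mem_dist (by positivity) (fun y hy => ?_) ?_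
  · rcases hrun.polyline_near H hη hε hA' hAA' hA'r hkK hqk y hy with hy | hy
    · obtain ⟨t, ht, hd⟩ := hp1 y hy
      exact ⟨γ t, Or.inl ⟨t, ht, rfl⟩, hd.trans (hle _ (by linarith))⟩
    · exact ⟨xstar, Or.inr rfl, (le_of_lt hy).trans (hle _ (by linarith))⟩
  · rintro _ (⟨t, ht, rfl⟩ | rfl)
    · rcases le_total t τ with htτ | htτ
      · obtain ⟨y, hy, hd⟩ := hp2 t ⟨ht, htτ⟩
        exact ⟨y, hpolyK hy, hd.trans (hle _ (by linarith))⟩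
      · refine ⟨q k, hpolyK (mem_polyline_self q k), ?_⟩
        have h1 := H.norm_sub_antitone hτT htτ
        have h2 := norm_sub_le_norm_sub_add_norm_sub (γ τ) (q k) xstar
        have h3 := norm_sub_le_norm_sub_add_norm_sub (γ t) xstar (q k)
        rw [norm_sub_rev (γ τ) (q k)] at h2
        rw [norm_sub_rev xstar] at h3
        rw [dist_eq_norm]
        have h4 := hle (B + 2 * A) (by linarith)
        linarith
    · refine ⟨q k, hpolyK (mem_polyline_self q k), ?_⟩
      rw [dist_comm, dist_eq_norm]
      exact hqk.trans (hle _ (by linarith))
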